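/- Let γ_K denote the standard Gaussian measure on ℝ^K. For every integer K ≥ 1, every β₀ ∈ ℝ^K and every real ε > 0, γ_K({β ∈ ℝ^K : ‖β − β₀‖₂² ≤ ε²K}) ≥ exp(−‖β₀‖₂²/2) · exp(−ε²K/4) · ε^K · K^{K/2} / (2^K · Γ(K/2 + 1)), where Γ is the Gamma function. -/

import Mathlib

open MeasureTheory ProbabilityTheory

theorem pi_gaussianReal_eq_withDensity (ι : Type*) [Fintype ι] :
    (Measure.pi fun _ : ι => gaussianReal 0 1) =
      (volume : Measure (ι → ℝ)).withDensity
        fun x => ENNReal.ofReal (∏ i, gaussianPDFReal 0 1 (x i)) := by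
  refine Measure.pi_eq fun s hs => ?_
  rw [withDensity_apply _ (MeasurableSet.univ_pi hs), volume_pi, Measure.restrict_pi_pi,
    ← ofReal_integral_eq_lintegral_ofReal
      (Integrable.fintype_prod fun i => (integrable_gaussianPDFReal 0 1).restrict)
      (Filter.Eventually.of_forall fun x =>
        Finset.prod_nonneg fun i _ => gaussianPDFReal_nonneg 0 1 (x i)),
    integral_fintype_prod_eq_prod (fun _ => gaussianPDFReal 0 1),
    ENNReal.ofReal_prod_of_nonneg fun i _ =>
      integral_nonneg fun x => gaussianPDFReal_nonneg 0 1 x]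
  exact Finset.prod_congr rfl fun i _ =>
    (gaussianReal_apply_eq_integral 0 one_ne_zero (s i)).symm

theorem prod_gaussianPDFReal_zero_one {ι : Type*} [Fintype ι] (x : ι → ℝ) :
    ∏ i, gaussianPDFReal 0 1 (x i) =
      (√(2 * Real.pi))⁻¹ ^ Fintype.card ι * Real.exp (-(∑ i, x i ^ 2) / 2) := by
  simp only [gaussianPDFReal, NNReal.coe_one, mul_one, sub_zero, Finset.prod_mul_distrib,
    Finset.prod_const, Finset.card_univ, ← Real.exp_sum, ← Finset.sum_div,
    Finset.sum_neg_distrib]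

theorem two_mul_exp_le_exp_add_exp (x y : ℝ) :
    2 * Real.exp ((x + y) / 2) ≤ Real.exp x + Real.exp y := by
  have hx : Real.exp x = Real.exp (x / 2) ^ 2 := by rw [← Real.exp_nat_mul]; ring_nf
  have hy : Real.exp y = Real.exp (y / 2) ^ 2 := by rw [← Real.exp_nat_mul]; ring_nf
  rw [hx, hy, add_div, Real.exp_add]
  nlinarith [sq_nonneg (Real.exp (x / 2) - Real.exp (y / 2))]

theorem mul_measure_le_setLIntegral_of_symmetric {E : Type*} [MeasurableSpace E] [AddGroup E]
    [MeasurableNeg E] {μ : Measure E} [μ.IsNegInvariant] {S : Set E} (hS : MeasurableSet S)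
    (hneg : ∀ u, -u ∈ S ↔ u ∈ S) {g : E → ENNReal} (hg : Measurable g) {c : ENNReal}
    (hc : ∀ u ∈ S, 2 * c ≤ g u + g (-u)) : c * μ S ≤ ∫⁻ u in S, g u ∂μ := by
  have hreflect : ∫⁻ u in S, g (-u) ∂μ = ∫⁻ u in S, g u ∂μ := by
    rw [← lintegral_indicator hS, ← lintegral_indicator hS,
      ← (Measure.measurePreserving_neg μ).lintegral_comp (hg.indicator hS)]
    refine lintegral_congr fun u => ?_
    by_cases hu : u ∈ S <;> simp [hu, hneg]
  have h : 2 * (c * μ S) ≤ 2 * ∫⁻ u in S, g u ∂μ :=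
    calc 2 * (c * μ S) = ∫⁻ _ in S, 2 * c ∂μ := by rw [setLIntegral_const, mul_assoc]
      _ ≤ ∫⁻ u in S, g u + g (-u) ∂μ := setLIntegral_mono' hS hc
      _ = 2 * ∫⁻ u in S, g u ∂μ := by rw [lintegral_add_left hg, hreflect, two_mul]
  exact (ENNReal.mul_le_mul_iff_right two_ne_zero ENNReal.ofNat_ne_top).1 h

theorem volume_sum_sq_le {ι : Type*} [Fintype ι] [Nonempty ι] {r : ℝ} (hr : 0 ≤ r) :
    volume {x : ι → ℝ | ∑ i, x i ^ 2 ≤ r ^ 2} =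
      ENNReal.ofReal (r ^ Fintype.card ι *
        (√Real.pi ^ Fintype.card ι / Real.Gamma (Fintype.card ι / 2 + 1))) := by
  rw [ENNReal.ofReal_mul (by positivity), ENNReal.ofReal_pow hr,
    ← EuclideanSpace.volume_closedBall ι (0 : EuclideanSpace ℝ ι),
    ← (PiLp.volume_preserving_toLp ι).measure_preimage
      Metric.isClosed_closedBall.measurableSet.nullMeasurableSet]
  congr 1 with x
  simp [EuclideanSpace.norm_eq, Real.sqrt_le_left hr]

/-!
STATEMENT 9: Let γ_K denote the standard Gaussian measure on ℝ^K. For every integer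
K ≥ 1, every β₀ ∈ ℝ^K and every real ε > 0,
γ_K({β : ‖β − β₀‖₂² ≤ ε²K}) ≥
  exp(−‖β₀‖₂²/2) · exp(−ε²K/4) · ε^K · K^{K/2} / (2^K · Γ(K/2 + 1)),
where Γ is the Gamma function.
-/

theorem statement9 (K : ℕ) (hK : 1 ≤ K) (β0 : Fin K → ℝ) (ε : ℝ) (hε : 0 < ε) :
    (Measure.pi fun _ : Fin K => gaussianReal 0 1)
        {β : Fin K → ℝ | ∑ k, (β k - β0 k) ^ 2 ≤ ε ^ 2 * K}
      ≥ ENNReal.ofReal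
          (Real.exp (-(∑ k, (β0 k) ^ 2) / 2) * Real.exp (-(ε ^ 2 * K) / 4) *
            ε ^ K * (K : ℝ) ^ ((K : ℝ) / 2) /
              (2 ^ K * Real.Gamma ((K : ℝ) / 2 + 1))) := by
  have : Nonempty (Fin K) := ⟨⟨0, hK⟩⟩
  set f : (Fin K → ℝ) → ENNReal := fun x => ENNReal.ofReal (∏ i, gaussianPDFReal 0 1 (x i))
  have hf : Measurable f := by
    have := measurable_gaussianPDFReal 0 1
    fun_prop
  set r : ℝ := ε * √(K / 2)
  have hr : 0 ≤ r := by positivity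
  have hr2 : r ^ 2 = ε ^ 2 * K / 2 := by
    rw [mul_pow, Real.sq_sqrt (by positivity)]; ring
  set S : Set (Fin K → ℝ) := {u | ∑ k, u k ^ 2 ≤ r ^ 2}
  have hS : MeasurableSet S := measurableSet_le (by fun_prop) measurable_const
  set A : Set (Fin K → ℝ) := {β | ∑ k, (β k - β0 k) ^ 2 ≤ ε ^ 2 * K}
  have hA : MeasurableSet A := measurableSet_le (by fun_prop) measurable_const
  set c : ℝ := (√(2 * Real.pi))⁻¹ ^ K * Real.exp (-(∑ k, β0 k ^ 2) / 2 + -(ε ^ 2 * K) / 4)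
  have hc : ∀ u ∈ S, 2 * ENNReal.ofReal c ≤ f (u + β0) + f (-u + β0) := by
    intro u hu
    have hu : ∑ k, u k ^ 2 ≤ r ^ 2 := hu
    have hsum : ∑ k, (u + β0) k ^ 2 + ∑ k, (-u + β0) k ^ 2 =
        2 * ∑ k, u k ^ 2 + 2 * ∑ k, β0 k ^ 2 := by
      simp only [Finset.mul_sum, ← Finset.sum_add_distrib, Pi.add_apply, Pi.neg_apply]
      exact Finset.sum_congr rfl fun k _ => by ring
    have hexp := two_mul_exp_le_exp_add_exp (-(∑ k, (u + β0) k ^ 2) / 2)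
      (-(∑ k, (-u + β0) k ^ 2) / 2)
    have hmono : Real.exp (-(∑ k, β0 k ^ 2) / 2 + -(ε ^ 2 * K) / 4) ≤
        Real.exp ((-(∑ k, (u + β0) k ^ 2) / 2 + -(∑ k, (-u + β0) k ^ 2) / 2) / 2) :=
      Real.exp_le_exp.2 (by linarith)
    have hpos : 0 ≤ (√(2 * Real.pi))⁻¹ ^ K := by positivity
    simp only [f, prod_gaussianPDFReal_zero_one, Fintype.card_fin]
    rw [← ENNReal.ofReal_add (by positivity) (by positivity), ← ENNReal.ofReal_ofNat 2,
      ← ENNReal.ofReal_mul zero_le_two]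
    refine ENNReal.ofReal_le_ofReal ?_
    rw [← mul_add, mul_left_comm]
    exact mul_le_mul_of_nonneg_left (by linarith) hpos
  have hball : ENNReal.ofReal c * volume S ≤ ∫⁻ u in S, f (u + β0) :=
    mul_measure_le_setLIntegral_of_symmetric hS (fun u => by simp [S])
      (hf.comp (measurable_add_const β0)) hc
  have hsub : ∫⁻ u in S, f (u + β0) ≤ ∫⁻ β in A, f β := by
    rw [← lintegral_indicator hS, ← lintegral_indicator hA,
      ← lintegral_add_right_eq_self (A.indicator f) β0]
    refine lintegral_mono fun u => Set.indicator_apply_le' (fun hu => ?_) fun _ => zero_le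
    have hu : ∑ k, u k ^ 2 ≤ r ^ 2 := hu
    have huA : u + β0 ∈ A := by
      have : 0 ≤ ε ^ 2 * K := by positivity
      simp only [A, Set.mem_ofPred_eq, Pi.add_apply, add_sub_cancel_right]
      linarith
    exact (Set.indicator_of_mem huA f).ge
  have hconst : Real.exp (-(∑ k, (β0 k) ^ 2) / 2) * Real.exp (-(ε ^ 2 * K) / 4) *
      ε ^ K * (K : ℝ) ^ ((K : ℝ) / 2) / (2 ^ K * Real.Gamma ((K : ℝ) / 2 + 1)) =
      c * (r ^ K * (√Real.pi ^ K / Real.Gamma (K / 2 + 1))) := by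
    have hKpow : (K : ℝ) ^ ((K : ℝ) / 2) = √(K : ℝ) ^ K := by
      rw [Real.sqrt_eq_rpow, ← Real.rpow_mul_natCast K.cast_nonneg]; ring_nf
    have h2 : (2 : ℝ) ^ K = √2 ^ K * √2 ^ K := by
      rw [← mul_pow, Real.mul_self_sqrt zero_le_two]
    have hpi : √Real.pi ^ K ≠ 0 := by positivity
    have hΓ : Real.Gamma ((K : ℝ) / 2 + 1) ≠ 0 := (Real.Gamma_pos_of_pos (by positivity)).ne'
    simp only [c, r]
    rw [hKpow, h2, Real.exp_add, Real.sqrt_mul zero_le_two, Real.sqrt_div K.cast_nonneg]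
    simp only [mul_pow, div_pow, inv_pow]
    field_simp
  rw [pi_gaussianReal_eq_withDensity, withDensity_apply _ hA, hconst,
    ENNReal.ofReal_mul (by positivity)]
  have hvol := volume_sum_sq_le (ι := Fin K) hr
  rw [Fintype.card_fin] at hvol
  rw [← hvol]
  exact hball.trans hsub
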